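/- arXiv:1908.08080 — 2 statements merged into one kernel-verified Lean document; each statement's English description precedes it below -/
import Mathlib

section
/- Every function f in the algebra 𝒟_w is of C₀ type, i.e., f ∘ T^{-1} : T(𝒫_w) → ℝ extends to a continuous function on 𝒳 vanishing at infinity. -/
open MeasureTheory Filter Topology
open scoped NNReal ENNReal ZeroAtInfty

noncomputable section

instance (X : Type*) [TopologicalSpace X] : MeasurableSpace (OnePoint X) := borel _
instance (X : Type*) [TopologicalSpace X] : BorelSpace (OnePoint X) := ⟨rfl⟩

/-- `w⁻¹` extended to `E^Δ` by `w⁻¹(Δ) = 0`. -/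
def winvOP {d : ℕ} (w : EuclideanSpace ℝ (Fin d) → ℝ) (E : Set (EuclideanSpace ℝ (Fin d))) :
    OnePoint E → ℝ :=
  fun z => z.elim 0 (fun y => (w y.1)⁻¹)

/-- The state space `𝒳 = {ν ∈ M_+(E^Δ) : ⟨w⁻¹,ν⟩ = 1}`, as a subtype of the space of finite
measures on `E^Δ` with the topology of weak convergence. -/
def XSp {d : ℕ} (w : EuclideanSpace ℝ (Fin d) → ℝ) (E : Set (EuclideanSpace ℝ (Fin d))) :
    Type :=
  {ν : FiniteMeasure (OnePoint E) //
    (∫⁻ x, ENNReal.ofReal (winvOP w E x) ∂(ν : Measure (OnePoint E))) = 1}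

instance {d : ℕ} (w : EuclideanSpace ℝ (Fin d) → ℝ) (E : Set (EuclideanSpace ℝ (Fin d))) :
    TopologicalSpace (XSp w E) :=
  instTopologicalSpaceSubtype

/-- The generators `μ ↦ ⟨φ,μ⟩ e^{-⟨w,μ⟩}`, `φ ∈ C_c^∞(ℝ^d)`, of the algebra `𝒟_w`. -/
def DwGen {d : ℕ} (w : EuclideanSpace ℝ (Fin d) → ℝ) (E : Set (EuclideanSpace ℝ (Fin d))) :
    Set (Measure E → ℝ) :=
  {g | ∃ φ : EuclideanSpace ℝ (Fin d) → ℝ, ContDiff ℝ (⊤ : ℕ∞) φ ∧ HasCompactSupport φ ∧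
    g = fun μ => (∫ x : E, φ x.1 ∂μ) * Real.exp (-(∫ x : E, w x.1 ∂μ))}

section Helpers

variable {d : ℕ} {w : EuclideanSpace ℝ (Fin d) → ℝ} {E : Set (EuclideanSpace ℝ (Fin d))}

lemma aux_cont (h : E → ℝ) (hc : Continuous h)
    (h0 : Tendsto h (cocompact E) (𝓝 0)) :
    Continuous (fun z : OnePoint E => (z.elim 0 h : ℝ)) := by
  rw [OnePoint.continuous_iff]
  refine ⟨?_, by simpa using hc⟩
  rw [coclosedCompact_eq_cocompact]
  simpa using h0

lemma aux_tend (hw_infty : Tendsto w (cocompact (EuclideanSpace ℝ (Fin d))) atTop)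
    (hE_closed : IsClosed E) :
    Tendsto (fun y : E => (w y.1)⁻¹) (cocompact E) (𝓝 0) :=
  tendsto_inv_atTop_zero.comp
    (hw_infty.comp hE_closed.isClosedEmbedding_subtypeVal.tendsto_cocompact)

lemma aux_t2 (hE_closed : IsClosed E) : T2Space (OnePoint E) := by
  haveI : LocallyCompactSpace E := hE_closed.locallyCompactSpace
  infer_instance

lemma aux_mass_tendsto (hw : Continuous w) (hw_one : ∀ x, 1 ≤ w x)
    (hw_infty : Tendsto w (cocompact (EuclideanSpace ℝ (Fin d))) atTop)
    (hE_closed : IsClosed E) :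
    Tendsto (fun ν : XSp w E => (ν.1.mass : ℝ)) (cocompact (XSp w E)) atTop := by
  haveI := aux_t2 hE_closed
  have hcw : Continuous (fun y : E => (w y.1)⁻¹) :=
    (hw.comp continuous_subtype_val).inv₀ fun y => by
      have := hw_one y.1
      simp only [Function.comp]; linarith
  have hc : Continuous (winvOP w E) := aux_cont _ hcw (aux_tend hw_infty hE_closed)
  have hnn : ∀ z, 0 ≤ winvOP w E z := by
    intro z
    induction z using OnePoint.rec with
    | infty => simp [winvOP]
    | coe y =>
      have := hw_one y.1
      simp only [winvOP, OnePoint.elim_some]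
      positivity
  let g : BoundedContinuousFunction (OnePoint E) ℝ :=
    BoundedContinuousFunction.mkOfCompact ⟨winvOP w E, hc⟩
  have key : ∀ ν : FiniteMeasure (OnePoint E),
      (∫⁻ x, ENNReal.ofReal (winvOP w E x) ∂(ν : Measure (OnePoint E))) = 1 ↔
      ∫ x, g x ∂(ν : Measure (OnePoint E)) = 1 := by
    intro ν
    have : ∫ x, g x ∂(ν : Measure (OnePoint E)) =
        (∫⁻ x, ENNReal.ofReal (winvOP w E x) ∂(ν : Measure (OnePoint E))).toReal :=
      integral_eq_lintegral_of_nonneg_ae (Eventually.of_forall hnn) hc.aestronglyMeasurable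
    rw [this, ENNReal.toReal_eq_one_iff]
  have hclosed : IsClosed {ν : FiniteMeasure (OnePoint E) |
      (∫⁻ x, ENNReal.ofReal (winvOP w E x) ∂(ν : Measure (OnePoint E))) = 1} := by
    simp_rw [key]
    exact isClosed_eq
      (FiniteMeasure.continuous_integral_boundedContinuousFunction g) continuous_const
  have hemb : IsClosedEmbedding (fun ν : XSp w E => ν.1) :=
    hclosed.isClosedEmbedding_subtypeVal
  rw [tendsto_atTop]
  intro R
  have hK : IsCompact ((fun ν : XSp w E => ν.1) ⁻¹'
      {μ : FiniteMeasure (OnePoint E) | μ.mass ≤ R.toNNReal}) :=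
    hemb.isCompact_preimage
      (isCompact_setOfPred_finiteMeasure_le_of_compactSpace (OnePoint E) R.toNNReal)
  filter_upwards [hK.compl_mem_cocompact] with ν hν
  have h1 : R.toNNReal < ν.1.mass := not_le.1 hν
  have h2 : ((R.toNNReal : ℝ≥0) : ℝ) < ν.1.mass := by exact_mod_cast h1
  exact (Real.le_coe_toNNReal R).trans h2.le

lemma aux_gen (hw : Continuous w) (hw_one : ∀ x, 1 ≤ w x)
    (hw_infty : Tendsto w (cocompact (EuclideanSpace ℝ (Fin d))) atTop)
    (hE_closed : IsClosed E) (φ : EuclideanSpace ℝ (Fin d) → ℝ) (hφ : Continuous φ)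
    (hφc : HasCompactSupport φ) :
    ∃ F : C₀(XSp w E, ℝ),
      ∀ μ : Measure E, IsProbabilityMeasure μ → Integrable (fun x : E => w x.1) μ →
        ∀ ν : XSp w E,
          (ν.1 : Measure (OnePoint E)) =
            (μ.withDensity (fun x => ENNReal.ofReal (w x.1))).map OnePoint.some →
          F ν = (∫ x : E, φ x.1 ∂μ) * Real.exp (-(∫ x : E, w x.1 ∂μ)) := by
  have hpos : ∀ x, 0 < w x := fun x => lt_of_lt_of_le one_pos (hw_one x)
  have hwE : Continuous (fun y : E => w y.1) := hw.comp continuous_subtype_val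
  let h : E → ℝ := fun y => φ y.1 * (w y.1)⁻¹
  have hh : Continuous h := (hφ.comp continuous_subtype_val).mul
    (hwE.inv₀ fun y => (hpos y.1).ne')
  have h0 : Tendsto h (cocompact E) (𝓝 0) := by
    have h1 : Tendsto (fun y : E => φ y.1) (cocompact E) (𝓝 0) :=
      hφc.is_zero_at_infty.comp hE_closed.isClosedEmbedding_subtypeVal.tendsto_cocompact
    simpa using h1.mul (aux_tend hw_infty hE_closed)
  let g : BoundedContinuousFunction (OnePoint E) ℝ :=
    BoundedContinuousFunction.mkOfCompact ⟨fun z => (z.elim 0 h : ℝ), aux_cont h hh h0⟩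
  let F : XSp w E → ℝ := fun ν =>
    (∫ x, g x ∂(ν.1 : Measure (OnePoint E))) * Real.exp (-(ν.1.mass : ℝ))
  have hval : Continuous (fun ν : XSp w E => ν.1) := continuous_subtype_val
  have hFc : Continuous F := by
    refine Continuous.mul
      ((FiniteMeasure.continuous_integral_boundedContinuousFunction g).comp hval) ?_
    exact Real.continuous_exp.comp
      (NNReal.continuous_coe.comp (FiniteMeasure.continuous_mass.comp hval)).neg
  have hF0 : Tendsto F (cocompact (XSp w E)) (𝓝 0) := by
    have hm := aux_mass_tendsto hw hw_one hw_infty hE_closed (E := E)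
    have h1 := ((Real.tendsto_pow_mul_exp_neg_atTop_nhds_zero 1).comp hm).const_mul ‖g‖
    rw [mul_zero] at h1
    refine squeeze_zero_norm (fun ν => ?_) h1
    have h2 : ‖∫ x, g x ∂(ν.1 : Measure (OnePoint E))‖ ≤ ‖g‖ * (ν.1.mass : ℝ) :=
      norm_integral_le_of_norm_le_const (Eventually.of_forall g.norm_coe_le_norm)
    simp only [F, norm_mul, Real.norm_eq_abs, Real.abs_exp, Function.comp, pow_one, ← mul_assoc]
    exact mul_le_mul_of_nonneg_right h2 (Real.exp_pos _).le
  refine ⟨⟨⟨F, hFc⟩, hF0⟩, ?_⟩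
  intro μ hμ hint ν hν
  change (∫ x, g x ∂(ν.1 : Measure (OnePoint E))) * Real.exp (-(ν.1.mass : ℝ)) = _
  have hsome : Measurable (OnePoint.some : E → OnePoint E) := OnePoint.continuous_coe.measurable
  have hmeas : Measurable (fun x : E => ENNReal.ofReal (w x.1)) :=
    hwE.measurable.ennreal_ofReal
  have e1 : ∫ x, g x ∂(ν.1 : Measure (OnePoint E)) = ∫ x : E, φ x.1 ∂μ := by
    rw [hν, integral_map hsome.aemeasurable g.continuous.aestronglyMeasurable,
      integral_withDensity_eq_integral_toReal_smul hmeas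
        (Eventually.of_forall fun x => ENNReal.ofReal_lt_top)]
    refine integral_congr_ae (Eventually.of_forall fun x => ?_)
    have : g (x : OnePoint E) = φ x.1 * (w x.1)⁻¹ := rfl
    have hp := hpos x.1
    simp only [this, smul_eq_mul, ENNReal.toReal_ofReal hp.le]
    field_simp
  have e2 : (ν.1.mass : ℝ) = ∫ x : E, w x.1 ∂μ := by
    have : (ν.1.mass : ℝ) = ((ν.1 : Measure (OnePoint E)) Set.univ).toReal := rfl
    rw [this, hν, Measure.map_apply hsome MeasurableSet.univ, Set.preimage_univ,
      withDensity_apply _ MeasurableSet.univ, Measure.restrict_univ,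
      integral_eq_lintegral_of_nonneg_ae (f := fun x : E => w x.1) (Eventually.of_forall fun x : E => (hpos x.1).le)
        hwE.aestronglyMeasurable]
  rw [e1, e2]

end Helpers

/-- Every function `f` in the (non-unital) algebra `𝒟_w` generated by the
functions `μ ↦ ⟨φ,μ⟩ e^{-⟨w,μ⟩}`, `φ ∈ C_c^∞(ℝ^d)`, is of `C₀` type: `f ∘ T⁻¹` extends to a
continuous function on `𝒳` vanishing at infinity. -/
theorem stmt_7 {d : ℕ} (w : EuclideanSpace ℝ (Fin d) → ℝ)
    (hw_smooth : ContDiff ℝ (⊤ : ℕ∞) w) (hw_one : ∀ x, 1 ≤ w x)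
    (hw_infty : Tendsto w (cocompact (EuclideanSpace ℝ (Fin d))) atTop)
    (E : Set (EuclideanSpace ℝ (Fin d))) (hE_closed : IsClosed E) (hE_noncompact : ¬ IsCompact E)
    (f : Measure E → ℝ) (hf : f ∈ NonUnitalAlgebra.adjoin ℝ (DwGen w E)) :
    ∃ F : C₀(XSp w E, ℝ),
      ∀ μ : Measure E, IsProbabilityMeasure μ → Integrable (fun x : E => w x.1) μ →
        ∀ ν : XSp w E,
          (ν.1 : Measure (OnePoint E)) =
            (μ.withDensity (fun x => ENNReal.ofReal (w x.1))).map OnePoint.some →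
          F ν = f μ := by
  have hw := hw_smooth.continuous
  induction hf using NonUnitalAlgebra.adjoin_induction with
  | mem g hg =>
    obtain ⟨φ, hφ, hφc, rfl⟩ := hg
    exact aux_gen hw hw_one hw_infty hE_closed φ hφ.continuous hφc
  | add f₁ f₂ _ _ h₁ h₂ =>
    obtain ⟨F₁, H₁⟩ := h₁
    obtain ⟨F₂, H₂⟩ := h₂
    exact ⟨F₁ + F₂, fun μ hμ hi ν hν => by
      simp [H₁ μ hμ hi ν hν, H₂ μ hμ hi ν hν]⟩
  | zero => exact ⟨0, fun μ hμ hi ν hν => by simp⟩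
  | mul f₁ f₂ _ _ h₁ h₂ =>
    obtain ⟨F₁, H₁⟩ := h₁
    obtain ⟨F₂, H₂⟩ := h₂
    exact ⟨F₁ * F₂, fun μ hμ hi ν hν => by
      simp [H₁ μ hμ hi ν hν, H₂ μ hμ hi ν hν]⟩
  | smul r f₁ _ h₁ =>
    obtain ⟨F₁, H₁⟩ := h₁
    exact ⟨r • F₁, fun μ hμ hi ν hν => by
      simp [H₁ μ hμ hi ν hν]⟩
end
end

section
/- The algebra 𝒟 is dense in C₀(𝒳) with respect to the supremum norm. -/
open MeasureTheory Filter Topology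
open scoped NNReal ENNReal ZeroAtInfty

noncomputable section

/-- The generators `ν ↦ ⟨φ,ν⟩ e^{-⟨1,ν⟩}`, `φ ∈ C_c^∞(ℝ^d)` (with `φ(Δ) := 0` and
`⟨1,ν⟩ = ν(E^Δ)`), of the algebra `𝒟`, viewed as functions on all of `M_+(E^Δ)`. -/
def DGen {d : ℕ} (E : Set (EuclideanSpace ℝ (Fin d))) :
    Set (FiniteMeasure (OnePoint E) → ℝ) :=
  {g | ∃ φ : EuclideanSpace ℝ (Fin d) → ℝ, ContDiff ℝ (⊤ : ℕ∞) φ ∧ HasCompactSupport φ ∧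
    g = fun ν => (∫ x, (x.elim 0 (fun y => φ y.1)) ∂ν.toMeasure) *
      Real.exp (-(ν.toMeasure Set.univ).toReal)}

open Manifold in
lemma aux_smooth {d : ℕ} {K : Set (EuclideanSpace ℝ (Fin d))} (hK : IsCompact K) :
    ∃ f : EuclideanSpace ℝ (Fin d) → ℝ, ContDiff ℝ (⊤ : ℕ∞) f ∧ HasCompactSupport f ∧
      (∀ x, 0 ≤ f x ∧ f x ≤ 1) ∧ (∀ x, x ∈ K ↔ f x = 1) := by
  obtain ⟨δ, δpos, hδ⟩ := hK.exists_isCompact_cthickening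
  obtain ⟨f, h1, h2, h3, h4⟩ := exists_contMDiff_support_eq_eq_one_iff (n := (⊤ : ℕ∞))
    𝓘(ℝ, EuclideanSpace ℝ (Fin d))
    (Metric.isOpen_thickening (δ := δ) (E := K)) hK.isClosed (Metric.self_subset_thickening δpos K)
  refine ⟨f, h1.contDiff, ?_, fun x => ⟨(h2 ⟨x, rfl⟩).1, (h2 ⟨x, rfl⟩).2⟩, h4⟩
  refine HasCompactSupport.intro hδ (fun x hx => ?_)
  by_contra hne
  have : x ∈ Function.support f := hne
  rw [h3] at this
  exact hx (Metric.thickening_subset_cthickening _ _ this)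

lemma aux_cont_s8 {d : ℕ} {E : Set (EuclideanSpace ℝ (Fin d))} (hE : IsClosed E)
    {f : EuclideanSpace ℝ (Fin d) → ℝ} (hf : Continuous f)
    (h0 : Tendsto f (cocompact _) (𝓝 0)) :
    Continuous (fun z : OnePoint E => (z.elim 0 (fun y : E => f y.1) : ℝ)) := by
  rw [OnePoint.continuous_iff]
  refine ⟨?_, ?_⟩
  · rw [Filter.coclosedCompact_eq_cocompact]
    exact h0.comp (hE.isClosedEmbedding_subtypeVal.tendsto_cocompact)
  · exact hf.comp continuous_subtype_val

lemma aux_compact {d : ℕ} {E : Set (EuclideanSpace ℝ (Fin d))} (hE : IsClosed E)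
    (P : Measure (OnePoint E)) [IsFiniteMeasure P] {K : Set E} (hK : IsCompact K)
    (f : EuclideanSpace ℝ (Fin d) → ℝ) (hf : Continuous f) (hfc : HasCompactSupport f)
    (h01 : ∀ x, 0 ≤ f x ∧ f x ≤ 1) (h1 : ∀ x, x ∈ Subtype.val '' K ↔ f x = 1) :
    Tendsto (fun n : ℕ => ∫ x, (x.elim 0 (fun y : E => f y.1 ^ (n + 1)) : ℝ) ∂P) atTop
      (𝓝 (P.real ((↑) '' K))) := by
  have hm : MeasurableSet ((↑) '' K : Set (OnePoint E)) :=
    (OnePoint.isClosed_image_coe.2 ⟨hK.isClosed, hK⟩).measurableSet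
  rw [← integral_indicator_one hm]
  refine tendsto_integral_of_dominated_convergence (fun _ => 1) ?_ (integrable_const _) ?_ ?_
  · intro n
    refine Continuous.aestronglyMeasurable ?_
    refine aux_cont_s8 hE (f := fun y => f y ^ (n + 1)) (hf.pow _) ?_
    refine (hfc.comp_left (g := fun t : ℝ => t ^ (n + 1)) (by simp)).is_zero_at_infty
  · intro n
    refine Eventually.of_forall fun z => ?_
    induction z using OnePoint.rec with
    | infty => simp
    | coe y =>
      simp only [OnePoint.elim_some, Real.norm_eq_abs, abs_pow]
      exact pow_le_one₀ (abs_nonneg _) (by rw [abs_of_nonneg (h01 _).1]; exact (h01 _).2)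
  · refine Eventually.of_forall fun z => ?_
    induction z using OnePoint.rec with
    | infty => simp
    | coe y =>
      simp only [OnePoint.elim_some]
      by_cases hy : y ∈ K
      · have : f y = 1 := (h1 _).1 ⟨y, hy, rfl⟩
        simp [this, hy]
      · have h : f y ≠ 1 := fun h => by
          obtain ⟨y', h1, h2⟩ := (h1 _).2 h
          exact hy (Subtype.ext h2 ▸ h1)
        have : f y < 1 := lt_of_le_of_ne (h01 _).2 h
        simp only [Set.indicator, Set.mem_image, OnePoint.coe_eq_coe, exists_eq_right, hy, if_false]
        exact (tendsto_pow_atTop_nhds_zero_of_lt_one (h01 _).1 this).comp (tendsto_add_atTop_nat 1)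

lemma aux_ext {d : ℕ} {E : Set (EuclideanSpace ℝ (Fin d))} (hE : IsClosed E)
    (P Q : Measure (OnePoint E)) [IsFiniteMeasure P] [IsFiniteMeasure Q]
    (h : ∀ φ : EuclideanSpace ℝ (Fin d) → ℝ, ContDiff ℝ (⊤ : ℕ∞) φ → HasCompactSupport φ →
      ∫ x, (x.elim 0 (fun y : E => φ y.1) : ℝ) ∂P = ∫ x, (x.elim 0 (fun y : E => φ y.1) : ℝ) ∂Q) :
    P.restrict {OnePoint.infty}ᶜ = Q.restrict {OnePoint.infty}ᶜ := by
  have hK : ∀ K : Set E, IsCompact K → P ((↑) '' K) = Q ((↑) '' K) := by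
    intro K hK
    obtain ⟨f, h1, h2, h3, h4⟩ := aux_smooth (hK.image continuous_subtype_val)
    have a := aux_compact hE P hK f h1.continuous h2 h3 h4
    have b := aux_compact hE Q hK f h1.continuous h2 h3 h4
    have : P.real ((↑) '' K) = Q.real ((↑) '' K) := by
      refine tendsto_nhds_unique a (b.congr fun n => ?_)
      exact (h (fun x => f x ^ (n + 1)) (h1.pow _)
        (h2.comp_left (g := fun t : ℝ => t ^ (n + 1)) (by simp))).symm
    exact (measureReal_eq_measureReal_iff).1 this
  have hemb : MeasurableEmbedding ((↑) : E → OnePoint E) :=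
    OnePoint.isOpenEmbedding_coe.measurableEmbedding
  have : LocallyCompactSpace E := hE.locallyCompactSpace
  have hc : P.comap ((↑) : E → OnePoint E) = Q.comap ((↑) : E → OnePoint E) := by
    refine Measure.ext_of_generateFrom_of_cover (S := {s | IsClosed s})
      (T := Set.range (compactCovering E)) ?_ (Set.countable_range _) isPiSystem_isClosed ?_ ?_ ?_ ?_
    · rw [BorelSpace.measurable_eq (α := E), borel_eq_generateFrom_isClosed]
    · rw [Set.sUnion_range, iUnion_compactCovering]
    · rintro _ ⟨n, rfl⟩
      rw [hemb.comap_apply]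
      exact measure_ne_top _ _
    · rintro _ ⟨n, rfl⟩ s hs
      rw [hemb.comap_apply, hemb.comap_apply]
      exact hK _ ((isCompact_compactCovering E n).inter_left hs)
    · rintro _ ⟨n, rfl⟩
      rw [hemb.comap_apply, hemb.comap_apply]
      exact hK _ ((isCompact_compactCovering E n))
  have := congrArg (Measure.map ((↑) : E → OnePoint E)) hc
  rwa [hemb.map_comap, hemb.map_comap, ← OnePoint.compl_infty] at this

lemma aux_lint {d : ℕ} (w : EuclideanSpace ℝ (Fin d) → ℝ) (E : Set (EuclideanSpace ℝ (Fin d)))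
    (P : Measure (OnePoint E)) :
    ∫⁻ x, ENNReal.ofReal (winvOP w E x) ∂(P.restrict {OnePoint.infty}ᶜ) =
      ∫⁻ x, ENNReal.ofReal (winvOP w E x) ∂P := by
  refine setLIntegral_eq_of_support_subset ?_ 
  intro x hx hx'
  simp only [Set.mem_singleton_iff] at hx'
  subst hx'
  simp [winvOP] at hx

lemma aux_contInt {d : ℕ} {E : Set (EuclideanSpace ℝ (Fin d))} (hE : IsClosed E)
    {f : EuclideanSpace ℝ (Fin d) → ℝ} (hf : Continuous f)
    (h0 : Tendsto f (cocompact _) (𝓝 0)) :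
    Continuous (fun ν : FiniteMeasure (OnePoint E) =>
      ∫ x, (x.elim 0 (fun y : E => f y.1) : ℝ) ∂ν.toMeasure) :=
  FiniteMeasure.continuous_integral_boundedContinuousFunction
    (BoundedContinuousFunction.mkOfCompact ⟨_, aux_cont_s8 hE hf h0⟩)

lemma aux_closed {d : ℕ} (w : EuclideanSpace ℝ (Fin d) → ℝ)
    (hw : Continuous w) (hw_one : ∀ x, 1 ≤ w x)
    (hw_infty : Tendsto w (cocompact (EuclideanSpace ℝ (Fin d))) atTop)
    (E : Set (EuclideanSpace ℝ (Fin d))) (hE : IsClosed E) :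
    IsClosed {ν : FiniteMeasure (OnePoint E) |
      (∫⁻ x, ENNReal.ofReal (winvOP w E x) ∂(ν : Measure (OnePoint E))) = 1} := by
  have hc : Continuous fun x => (w x)⁻¹ :=
    hw.inv₀ fun x => (lt_of_lt_of_le one_pos (hw_one x)).ne'
  have h0 := tendsto_inv_atTop_zero.comp hw_infty
  have := isClosed_singleton (x := (1 : ℝ)) |>.preimage (aux_contInt hE hc h0)
  convert this using 1
  ext ν
  simp only [Set.mem_preimage, Set.mem_singleton_iff]
  change _ = _ ↔ ∫ x, winvOP w E x ∂ν.toMeasure = 1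
  rw [integral_eq_lintegral_of_nonneg_ae, ENNReal.toReal_eq_one_iff]
  · refine Eventually.of_forall fun z => ?_
    induction z using OnePoint.rec with
    | infty => simp [winvOP]
    | coe y => simpa [winvOP] using zero_le_one.trans (hw_one y)
  · exact (aux_cont_s8 hE hc h0).aestronglyMeasurable

lemma aux_mass {d : ℕ} (w : EuclideanSpace ℝ (Fin d) → ℝ)
    (hw : Continuous w) (hw_one : ∀ x, 1 ≤ w x)
    (hw_infty : Tendsto w (cocompact (EuclideanSpace ℝ (Fin d))) atTop)
    (E : Set (EuclideanSpace ℝ (Fin d))) (hE : IsClosed E) :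
    Tendsto (fun ν : XSp w E => (ν.1.toMeasure Set.univ).toReal) (coclosedCompact _) atTop := by
  have : LocallyCompactSpace E := hE.locallyCompactSpace
  have hemb : IsClosedEmbedding (Subtype.val : XSp w E → FiniteMeasure (OnePoint E)) :=
    (aux_closed w hw hw_one hw_infty E hE).isClosedEmbedding_subtypeVal
  rw [tendsto_atTop]
  intro r
  have hcl : IsClosed {ν : XSp w E | ν.1.mass ≤ r.toNNReal} :=
    isClosed_le (FiniteMeasure.continuous_mass.comp hemb.continuous) continuous_const
  have hco : IsCompact {ν : XSp w E | ν.1.mass ≤ r.toNNReal} :=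
    hemb.isCompact_preimage
      (isCompact_setOfPred_finiteMeasure_le_of_compactSpace (OnePoint E) r.toNNReal)
  filter_upwards [(hco.compl_mem_coclosedCompact_of_isClosed hcl)] with ν hν
  have h : r.toNNReal < ν.1.mass := not_le.1 hν
  have h2 : r < ν.1.mass := (Real.le_coe_toNNReal r).trans_lt (NNReal.coe_lt_coe.2 h)
  exact h2.le

/-- generator function -/
def gfun {d : ℕ} (E : Set (EuclideanSpace ℝ (Fin d))) (φ : EuclideanSpace ℝ (Fin d) → ℝ) :
    FiniteMeasure (OnePoint E) → ℝ :=
  fun ν => (∫ x, (x.elim 0 (fun y => φ y.1)) ∂ν.toMeasure) *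
      Real.exp (-(ν.toMeasure Set.univ).toReal)

lemma aux_gcont {d : ℕ} (w : EuclideanSpace ℝ (Fin d) → ℝ)
    (hw : Continuous w) (hw_one : ∀ x, 1 ≤ w x)
    (hw_infty : Tendsto w (cocompact (EuclideanSpace ℝ (Fin d))) atTop)
    (E : Set (EuclideanSpace ℝ (Fin d))) (hE : IsClosed E)
    (φ : EuclideanSpace ℝ (Fin d) → ℝ) (hφ : Continuous φ) (hc : HasCompactSupport φ) :
    Continuous (fun z : OnePoint (XSp w E) => (z.elim 0 (fun ν => gfun E φ ν.1) : ℝ)) := by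
  rw [OnePoint.continuous_iff]
  refine ⟨?_, ?_⟩
  · obtain ⟨C, hC⟩ := hφ.bounded_above_of_compact_support hc
    have hm := aux_mass w hw hw_one hw_infty E hE
    have h1 := ((Real.tendsto_pow_mul_exp_neg_atTop_nhds_zero 1).comp hm).const_mul |C|
    rw [mul_zero] at h1
    refine squeeze_zero_norm (fun ν => ?_) h1
    simp only [OnePoint.elim_some, gfun, norm_mul, Function.comp_apply, pow_one, ← mul_assoc]
    rw [Real.norm_of_nonneg (Real.exp_nonneg _)]
    refine mul_le_mul_of_nonneg_right ?_ (Real.exp_nonneg _)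
    refine norm_integral_le_of_norm_le_const (Eventually.of_forall fun z => ?_)
    induction z using OnePoint.rec with
    | infty => simp
    | coe y => exact (hC y).trans (le_abs_self C)
  · refine Continuous.mul ((aux_contInt hE hφ hc.is_zero_at_infty).comp continuous_subtype_val) ?_
    refine Real.continuous_exp.comp (Continuous.neg ?_)
    exact NNReal.continuous_coe.comp (FiniteMeasure.continuous_mass.comp continuous_subtype_val)

lemma aux_nonvanish {d : ℕ} (w : EuclideanSpace ℝ (Fin d) → ℝ)
    (E : Set (EuclideanSpace ℝ (Fin d))) (hE : IsClosed E) (ν : XSp w E)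
    (h : ∀ φ : EuclideanSpace ℝ (Fin d) → ℝ, ContDiff ℝ (⊤ : ℕ∞) φ → HasCompactSupport φ →
      gfun E φ ν.1 = 0) : False := by
  have h1 := aux_ext hE ν.1.toMeasure 0 (fun φ h1 h2 => by
    have := h φ h1 h2
    simp only [gfun, mul_eq_zero, (Real.exp_pos _).ne', or_false] at this
    rw [this]; simp)
  have h2 := aux_lint w E ν.1.toMeasure
  rw [h1, ν.2] at h2
  simp at h2

lemma aux_sep {d : ℕ} (w : EuclideanSpace ℝ (Fin d) → ℝ)
    (E : Set (EuclideanSpace ℝ (Fin d))) (hE : IsClosed E) (ν μ : XSp w E)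
    (h : ∀ φ : EuclideanSpace ℝ (Fin d) → ℝ, ContDiff ℝ (⊤ : ℕ∞) φ → HasCompactSupport φ →
      gfun E φ ν.1 = gfun E φ μ.1) : ν = μ := by
  set a : ℝ≥0 := (Real.exp (-(ν.1.toMeasure Set.univ).toReal)).toNNReal with ha
  set b : ℝ≥0 := (Real.exp (-(μ.1.toMeasure Set.univ).toReal)).toNNReal with hb
  have h1 := aux_ext hE (a • ν.1.toMeasure) (b • μ.1.toMeasure) (fun φ h1 h2 => by
    have := h φ h1 h2
    simp only [gfun] at this
    rw [integral_smul_nnreal_measure, integral_smul_nnreal_measure, NNReal.smul_def, NNReal.smul_def, ha, hb,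
      Real.coe_toNNReal _ (Real.exp_nonneg _), Real.coe_toNNReal _ (Real.exp_nonneg _),
      smul_eq_mul, smul_eq_mul]
    linarith)
  have hab : a = b := by
    have h2 := aux_lint w E (a • ν.1.toMeasure)
    have h3 := aux_lint w E (b • μ.1.toMeasure)
    rw [h1, h3, lintegral_smul_measure, lintegral_smul_measure, ν.2, μ.2] at h2
    simpa [ENNReal.smul_def] using h2.symm
  have hm : ν.1.toMeasure Set.univ = μ.1.toMeasure Set.univ := by
    rw [ha, hb, Real.toNNReal_eq_toNNReal_iff (Real.exp_nonneg _) (Real.exp_nonneg _),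
      Real.exp_eq_exp, neg_inj] at hab
    exact (ENNReal.toReal_eq_toReal_iff' (measure_ne_top _ _) (measure_ne_top _ _)).1 hab
  have ha0 : a ≠ 0 := by
    rw [ha]; simp [Real.exp_pos]
  have hr : ν.1.toMeasure.restrict {OnePoint.infty}ᶜ = μ.1.toMeasure.restrict {OnePoint.infty}ᶜ := by
    rw [← hab, Measure.restrict_smul, Measure.restrict_smul] at h1
    have := congrArg (fun P => a⁻¹ • P) h1
    simpa [smul_smul, ha0] using this
  have hmeas : MeasurableSet ({OnePoint.infty} : Set (OnePoint E)) :=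
    OnePoint.isClosed_infty.measurableSet
  have hinf : ν.1.toMeasure {OnePoint.infty} = μ.1.toMeasure {OnePoint.infty} := by
    have e := congrArg (fun P => P Set.univ) hr
    simp only [Measure.restrict_apply_univ] at e
    have e1 := measure_compl hmeas.compl (measure_ne_top ν.1.toMeasure _)
    have e2 := measure_compl hmeas.compl (measure_ne_top μ.1.toMeasure _)
    rw [compl_compl] at e1 e2
    rw [e1, e2, hm, e]
  refine Subtype.ext (Subtype.ext ?_)
  change ν.1.toMeasure = μ.1.toMeasure
  rw [← Measure.restrict_add_restrict_compl (μ := ν.1.toMeasure) hmeas,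
    ← Measure.restrict_add_restrict_compl (μ := μ.1.toMeasure) hmeas, hr,
    Measure.restrict_singleton, Measure.restrict_singleton, hinf]

/-- the unitized algebra on the compactification -/
def auxAlg {d : ℕ} (w : EuclideanSpace ℝ (Fin d) → ℝ)
    (E : Set (EuclideanSpace ℝ (Fin d))) : Subalgebra ℝ C(OnePoint (XSp w E), ℝ) where
  carrier := {h | ∃ c : ℝ, ∃ g ∈ NonUnitalAlgebra.adjoin ℝ (DGen E),
    h OnePoint.infty = c ∧ ∀ ν : XSp w E, h (ν : OnePoint (XSp w E)) = c + g ν.1}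
  mul_mem' := by
    rintro h h' ⟨c, g, hg, h1, h2⟩ ⟨c', g', hg', h1', h2'⟩
    refine ⟨c * c', c • g' + c' • g + g * g', ?_, ?_, ?_⟩
    · exact add_mem (add_mem (SMulMemClass.smul_mem _ hg') (SMulMemClass.smul_mem _ hg))
        (mul_mem hg hg')
    · simp [h1, h1']
    · intro ν
      simp only [ContinuousMap.mul_apply, h2, h2', Pi.add_apply, Pi.smul_apply, Pi.mul_apply,
        smul_eq_mul]
      ring
  add_mem' := by
    rintro h h' ⟨c, g, hg, h1, h2⟩ ⟨c', g', hg', h1', h2'⟩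
    refine ⟨c + c', g + g', add_mem hg hg', ?_, ?_⟩
    · simp [h1, h1']
    · intro ν
      simp only [ContinuousMap.add_apply, h2, h2', Pi.add_apply]
      ring
  algebraMap_mem' := by
    intro r
    exact ⟨r, 0, zero_mem _, by simp, by simp⟩

/-- The (non-unital) algebra `𝒟` generated by the functions
`ν ↦ ⟨φ,ν⟩ e^{-⟨1,ν⟩}` with `φ ∈ C_c^∞(ℝ^d)` is dense in `C₀(𝒳)` for the supremum norm. -/
theorem stmt_8 {d : ℕ} (w : EuclideanSpace ℝ (Fin d) → ℝ)
    (hw_smooth : ContDiff ℝ (⊤ : ℕ∞) w) (hw_one : ∀ x, 1 ≤ w x)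
    (hw_infty : Tendsto w (cocompact (EuclideanSpace ℝ (Fin d))) atTop)
    (E : Set (EuclideanSpace ℝ (Fin d))) (hE_closed : IsClosed E) (hE_noncompact : ¬ IsCompact E) :
    ∀ F : C₀(XSp w E, ℝ), ∀ ε : ℝ, 0 < ε →
      ∃ g ∈ NonUnitalAlgebra.adjoin ℝ (DGen E),
        ∀ ν : XSp w E, |F ν - g ν.1| ≤ ε := by
  intro F ε hε
  have hw := hw_smooth.continuous
  have hsep : (auxAlg w E).SeparatesPoints := by
    have key : ∀ x y : OnePoint (XSp w E),
        (∀ φ : EuclideanSpace ℝ (Fin d) → ℝ, ContDiff ℝ (⊤ : ℕ∞) φ → HasCompactSupport φ →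
          (x.elim 0 (fun ν => gfun E φ ν.1) : ℝ) = y.elim 0 (fun ν => gfun E φ ν.1)) → x = y := by
      intro x y h
      induction x using OnePoint.rec with
      | infty =>
        induction y using OnePoint.rec with
        | infty => rfl
        | coe μ => exact (aux_nonvanish w E hE_closed μ fun φ h1 h2 => (h φ h1 h2).symm).elim
      | coe ν =>
        induction y using OnePoint.rec with
        | infty => exact (aux_nonvanish w E hE_closed ν fun φ h1 h2 => (h φ h1 h2)).elim
        | coe μ => exact congrArg _ (aux_sep w E hE_closed ν μ h)
    intro x y hxy
    by_contra hcon
    refine hxy (key x y fun φ h1 h2 => ?_)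
    by_contra hne
    refine hcon ⟨_, ⟨⟨_, aux_gcont w hw hw_one hw_infty E hE_closed φ h1.continuous h2⟩,
      ⟨0, gfun E φ, NonUnitalAlgebra.subset_adjoin ℝ ⟨φ, h1, h2, rfl⟩, rfl, fun ν => ?_⟩, rfl⟩, hne⟩
    simp
  have hF : Continuous (fun z : OnePoint (XSp w E) => (z.elim 0 (fun ν => F ν) : ℝ)) := by
    rw [OnePoint.continuous_iff]
    refine ⟨?_, F.continuous⟩
    rw [Metric.tendsto_nhds]
    intro δ hδ
    obtain ⟨K, hK, hKs⟩ := mem_cocompact.1 ((Metric.tendsto_nhds.1 F.zero_at_infty') δ hδ)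
    have hcl : IsClosed {ν : XSp w E | δ ≤ dist (F ν) 0} :=
      isClosed_le continuous_const (F.continuous.dist continuous_const)
    have hco : IsCompact {ν : XSp w E | δ ≤ dist (F ν) 0} := by
      refine hK.of_isClosed_subset hcl fun ν hν => ?_
      by_contra hn
      have h3 : dist (F ν) 0 < δ := hKs hn
      have h4 : δ ≤ dist (F ν) 0 := hν
      exact absurd h3 (not_lt.2 h4)
    filter_upwards [hco.compl_mem_coclosedCompact_of_isClosed hcl] with ν hν
    exact not_le.1 hν
  obtain ⟨⟨h, c, g, hg, h1, h2⟩, hh⟩ :=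
    ContinuousMap.exists_mem_subalgebra_near_continuousMap_of_separatesPoints (auxAlg w E) hsep
      ⟨_, hF⟩ (ε / 2) (half_pos hε)
  refine ⟨g, hg, fun ν => ?_⟩
  have e1 := (ContinuousMap.norm_coe_le_norm _ (OnePoint.infty)).trans hh.le
  have e2 := (ContinuousMap.norm_coe_le_norm _ (ν : OnePoint (XSp w E))).trans hh.le
  simp only [ContinuousMap.sub_apply, h1, h2, ContinuousMap.coe_mk, OnePoint.elim_infty,
    OnePoint.elim_some, Real.norm_eq_abs, abs_le] at e1 e2
  rw [abs_le]
  constructor <;> linarith [e1.1, e1.2, e2.1, e2.2]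
end
end
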